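/- Let u = u_0 u_1 u_2 … be an infinite sequence over a finite alphabet that is not ultimately periodic. Then for all k ≥ 1, pal_u(k) < (16/k) · fac_u(k + ⌊k/4⌋); equivalently, k · pal_u(k) < 16 · fac_u(k + ⌊k/4⌋). -/

import Mathlib

namespace PalPaper

variable {α : Type*}

/-- The finite word `u i, u (i+1), …, u (i+k-1)` read off the infinite sequence `u`. -/
def factorAt (u : ℕ → α) (i k : ℕ) : List α :=
  (List.range k).map fun j => u (i + j)

/-- `w` occurs as a contiguous block (factor) in the infinite sequence `u`. -/
def IsFactor (u : ℕ → α) (w : List α) : Prop :=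
  ∃ i, w = factorAt u i w.length

/-- A palindrome is a word equal to its reversal. -/
def IsPalindrome (w : List α) : Prop := w.reverse = w

/-- Number of distinct factors of length `k` of `u`. -/
noncomputable def facComplexity (u : ℕ → α) (k : ℕ) : ℕ :=
  Set.ncard {w : List α | w.length = k ∧ IsFactor u w}

/-- Number of distinct palindromic factors of length `k` of `u`. -/
noncomputable def palComplexity (u : ℕ → α) (k : ℕ) : ℕ :=
  Set.ncard {w : List α | w.length = k ∧ IsFactor u w ∧ IsPalindrome w}

/-- `p ≥ 1` is a period of the finite word `w`. -/
def IsPeriodOf (p : ℕ) (w : List α) : Prop :=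
  1 ≤ p ∧ ∀ i (h : i + p < w.length), w[i]'(by omega) = w[i + p]'h

/-- The minimal period of a finite word. -/
noncomputable def minPeriod (w : List α) : ℕ := sInf {p | IsPeriodOf p w}

/-- The prefix of length `m` of the infinite sequence `u`, as a finite word. -/
def seqPrefix (u : ℕ → α) (m : ℕ) : List α := (List.range m).map u

/-- The word `σ(u 0) σ(u 1) ⋯ σ(u (n-1))`. -/
def substPrefix (σ : α → List α) (u : ℕ → α) (n : ℕ) : List α :=
  (List.range n).flatMap fun i => σ (u i)

/-- `v = σ(u)`: every word `σ(u 0) ⋯ σ(u (n-1))` is the corresponding prefix of `v`. -/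
def IsMorphicImage (σ : α → List α) (u v : ℕ → α) : Prop :=
  ∀ n, substPrefix σ u n = seqPrefix v (substPrefix σ u n).length

/-- `u` is a fixed point of the morphism `σ`, i.e. `σ(u) = u`. -/
def IsFixedPointOf (σ : α → List α) (u : ℕ → α) : Prop := IsMorphicImage σ u u

/-- The `k`-th iterate of a morphism, applied to a letter. -/
def morphIter (σ : α → List α) : ℕ → α → List α
  | 0, a => [a]
  | k + 1, a => (σ a).flatMap (morphIter σ k)

/-- A morphism is primitive if some iterate maps every letter to a word
containing every letter. -/
def IsPrimitive (σ : α → List α) : Prop :=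
  ∃ k, 1 ≤ k ∧ ∀ a b : α, b ∈ morphIter σ k a

/-- A sequence is ultimately periodic if it is periodic from some index on. -/
def UltimatelyPeriodic (u : ℕ → α) : Prop :=
  ∃ (l T : ℕ), 1 ≤ T ∧ ∀ n, l ≤ n → u (n + T) = u n

/-- `u` has period `p` on the interval `[a, b)`. -/
def HasPeriodOn (u : ℕ → α) (a b p : ℕ) : Prop :=
  ∀ i, a ≤ i → i + p < b → u i = u (i + p)

/-- The factor of length `k` of `u` at position `c` is invariant under reflection. -/
def IsPalindromeAt (u : ℕ → α) (k c : ℕ) : Prop :=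
  ∀ i j, c ≤ i → c ≤ j → i + j + 1 = 2 * c + k → u i = u j

theorem length_factorAt (u : ℕ → α) (i k : ℕ) : (factorAt u i k).length = k := by
  simp [factorAt]

theorem isFactor_factorAt (u : ℕ → α) (i k : ℕ) : IsFactor u (factorAt u i k) :=
  ⟨i, by rw [length_factorAt]⟩

theorem factorAt_eq_iff {u : ℕ → α} {i j k : ℕ} :
    factorAt u i k = factorAt u j k ↔ ∀ t < k, u (i + t) = u (j + t) := by
  simp [factorAt]

theorem take_drop_factorAt (u : ℕ → α) {s j k n : ℕ} (h : j + k ≤ n) :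
    ((factorAt u s n).drop j).take k = factorAt u (s + j) k := by
  apply List.ext_getElem
  · simp [factorAt]; omega
  · intro t h₁ h₂
    simp [factorAt, add_assoc]

theorem IsPalindrome.isPalindromeAt {u : ℕ → α} {k c : ℕ}
    (h : IsPalindrome (factorAt u c k)) : IsPalindromeAt u k c := by
  intro i j hi hj hij
  have hl : i - c < (factorAt u c k).reverse.length := by
    simp only [List.length_reverse, length_factorAt]; omega
  have key : (factorAt u c k).reverse[i - c]'hl
      = (factorAt u c k)[i - c]'(by simpa using hl) := by
    congr 1
  simp only [List.getElem_reverse, factorAt, List.getElem_map, List.getElem_range,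
    List.length_map, List.length_range] at key
  rw [show c + (k - 1 - (i - c)) = j by omega, show c + (i - c) = i by omega] at key
  exact key.symm

theorem IsPalindromeAt.hasPeriodOn {u : ℕ → α} {k c d : ℕ} (h : IsPalindromeAt u k c)
    (h' : IsPalindromeAt u k (c + d)) : HasPeriodOn u c (c + d + k) (2 * d) := by
  intro i hi hlt
  rw [h i (2 * c + k - 1 - i) hi (by omega) (by omega)]
  exact h' _ _ (by omega) (by omega) (by omega)

theorem HasPeriodOn.mul {u : ℕ → α} {a b p : ℕ} (h : HasPeriodOn u a b p) (m : ℕ) :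
    HasPeriodOn u a b (p * m) := by
  induction m with
  | zero => intro i _ _; simp
  | succ m ih =>
    intro i hi hlt
    rw [Nat.mul_succ] at hlt ⊢
    rw [ih i hi (by omega), h (i + p * m) (by omega) (by omega), add_assoc]

theorem HasPeriodOn.sub {u : ℕ → α} {a b p r : ℕ} (hp : HasPeriodOn u a b p)
    (hr : HasPeriodOn u a b (r + p)) (hb : a + (r + p) + p ≤ b) : HasPeriodOn u a b r := by
  intro i hi hlt
  rcases Nat.lt_or_ge i (a + p) with h | h
  · have h₁ := hr i hi (by omega)
    have h₂ := hp (i + r) (by omega) (by omega)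
    rw [h₁, h₂, add_assoc]
  · have h₁ := hp (i - p) (by omega) (by omega)
    have h₂ := hr (i - p) (by omega) (by omega)
    rw [show i - p + p = i by omega] at h₁
    rw [show i - p + (r + p) = i + r by omega] at h₂
    rw [← h₁, h₂]

/-- A weak form of the theorem of Fine and Wilf. -/
theorem HasPeriodOn.gcd {u : ℕ → α} {a b : ℕ} (p r : ℕ) (hp : HasPeriodOn u a b p)
    (hr : HasPeriodOn u a b r) (hb : a + p + r ≤ b) : HasPeriodOn u a b (Nat.gcd p r) := by
  induction hn : p + r using Nat.strong_induction_on generalizing p r with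
  | _ n ih =>
    rcases Nat.eq_zero_or_pos p with rfl | hp0
    · simpa using hr
    rcases Nat.eq_zero_or_pos r with rfl | hr0
    · simpa using hp
    rcases le_total p r with h | h
    · obtain ⟨t, rfl⟩ := Nat.exists_eq_add_of_le' h
      have := ih (p + t) (by omega) p t hp (hp.sub hr (by omega)) (by omega) rfl
      simpa using this
    · obtain ⟨t, rfl⟩ := Nat.exists_eq_add_of_le' h
      have := ih (t + r) (by omega) t r (hr.sub hp (by omega)) hr (by omega) rfl
      simpa using this

/-- A period of a long enough final part of an interval that divides a period of the interval
is a period of the whole interval. -/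
theorem HasPeriodOn.extend_left {u : ℕ → α} {a a' b p g : ℕ} (hg : HasPeriodOn u a' b g)
    (hp : HasPeriodOn u a b p) (ha : a' ≤ a + p) (hb : a' + p + g ≤ b) :
    HasPeriodOn u a b g := by
  intro i hi hlt
  rcases Nat.lt_or_ge i a' with h | h
  · rw [hp i hi (by omega), hp (i + g) (by omega) (by omega), hg (i + p) (by omega) (by omega)]
    congr 1; omega
  · exact hg i h hlt

theorem HasPeriodOn.extend_right {u : ℕ → α} {a b b' p g : ℕ} (hg : HasPeriodOn u a b' g)
    (hp : HasPeriodOn u a b p) (hb' : b ≤ b' + p) (hb : a + p + g ≤ b') :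
    HasPeriodOn u a b g := by
  intro i hi hlt
  rcases Nat.lt_or_ge (i + g) b' with h | h
  · exact hg i hi h
  · have h₁ := hp (i - p) (by omega) (by omega)
    have h₂ := hp (i - p + g) (by omega) (by omega)
    have h₃ := hg (i - p) (by omega) (by omega)
    rw [show i - p + p = i by omega] at h₁
    rw [show i - p + g + p = i + g by omega] at h₂
    rw [← h₁, h₃, h₂]

theorem HasPeriodOn.glue {u : ℕ → α} {a a' b b' g : ℕ} (h : HasPeriodOn u a b' g)
    (h' : HasPeriodOn u a' b g) (hab : a' + g ≤ b') : HasPeriodOn u a b g := by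
  intro i hi hlt
  rcases Nat.lt_or_ge (i + g) b' with hb | hb
  · exact h i hi hb
  · exact h' i (by omega) hlt

theorem HasPeriodOn.factorAt_eq {u : ℕ → α} {a b p : ℕ} (h : HasPeriodOn u a b p) {m e i k : ℕ}
    (he : e = p * m) (hi : a ≤ i) (hb : i + e + k ≤ b) :
    factorAt u i k = factorAt u (i + e) k := by
  rw [factorAt_eq_iff]
  intro t ht
  have := h.mul m (i + t) (by omega) (by omega)
  rw [this, ← he]
  congr 1; omega

/-- Among three palindromes of length `k` at close positions, two coincide. -/
theorem factorAt_eq_of_isPalindromeAt {u : ℕ → α} {k q c d e : ℕ} (hq : 4 * q ≤ k)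
    (hde : d + e ≤ q) (h₁ : IsPalindromeAt u k c) (h₂ : IsPalindromeAt u k (c + d))
    (h₃ : IsPalindromeAt u k (c + d + e)) :
    factorAt u c k = factorAt u (c + d) k ∨
      factorAt u (c + d) k = factorAt u (c + d + e) k ∨
      factorAt u c k = factorAt u (c + d + e) k := by
  rcases Nat.eq_zero_or_pos d with rfl | hd
  · exact Or.inl rfl
  rcases Nat.eq_zero_or_pos e with rfl | he
  · exact Or.inr (Or.inl rfl)
  have hp₁ := h₁.hasPeriodOn h₂
  have hp₂ := h₂.hasPeriodOn h₃
  have hG : HasPeriodOn u (c + d) (c + d + k) (Nat.gcd (2 * d) (2 * e)) :=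
    HasPeriodOn.gcd _ _ (fun i hi hlt => hp₁ i (by omega) hlt)
      (fun i hi hlt => hp₂ i hi (by omega)) (by omega)
  rw [Nat.gcd_mul_left] at hG
  have hgd : Nat.gcd d e ≤ d := Nat.gcd_le_left _ hd
  have hge : Nat.gcd d e ≤ e := Nat.gcd_le_right _ he
  have hL := hG.extend_left hp₁ (by omega) (by omega)
  have hR := hG.extend_right hp₂ (by omega) (by omega)
  have hU := hL.glue hR (by omega)
  obtain ⟨x, hx⟩ := Nat.gcd_dvd_left d e
  obtain ⟨y, hy⟩ := Nat.gcd_dvd_right d e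
  rcases Nat.even_or_odd' x with ⟨m, hm | hm⟩
  · exact Or.inl (hU.factorAt_eq (m := m) (by rw [hm] at hx; linarith) (by omega) (by omega))
  rcases Nat.even_or_odd' y with ⟨n, hn | hn⟩
  · exact Or.inr (Or.inl
      (hU.factorAt_eq (m := n) (by rw [hn] at hy; linarith) (by omega) (by omega)))
  · refine Or.inr (Or.inr ?_)
    rw [add_assoc]
    refine hU.factorAt_eq (m := m + n + 1) ?_ (by omega) (by omega)
    rw [hm] at hx; rw [hn] at hy; linarith

/-- In a sequence that is not ultimately periodic, every periodic stretch can be prolonged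
maximally to the right. -/
theorem HasPeriodOn.exists_break {u : ℕ → α} (hu : ¬ UltimatelyPeriodic u) {a b₀ p : ℕ}
    (hp : 1 ≤ p) (h : HasPeriodOn u a b₀ p) :
    ∃ b, b₀ ≤ b ∧ a + p ≤ b ∧ HasPeriodOn u a b p ∧ u b ≠ u (b - p) := by
  classical
  have hex : ∃ n, a ≤ n ∧ u (n + p) ≠ u n := by
    by_contra! hcon
    exact hu ⟨a, p, hp, hcon⟩
  obtain ⟨hn₁, hn₂⟩ := Nat.find_spec hex
  refine ⟨Nat.find hex + p, ?_, by omega, ?_, by simpa using hn₂⟩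
  · by_contra! hlt
    exact hn₂ (h _ hn₁ hlt).symm
  · intro i hi hlt
    by_contra hne
    exact Nat.find_min hex (m := i) (by omega) ⟨hi, fun h => hne h.symm⟩

/-- Two windows that see the end of a periodic stretch at different offsets are different. -/
theorem HasPeriodOn.factorAt_ne {u : ℕ → α} {a b p n s₁ s₂ : ℕ} (h : HasPeriodOn u a b p)
    (hb : u b ≠ u (b - p)) (hs : s₁ < s₂) (hs₂ : s₂ + p ≤ b) (hn : b < s₂ + n)
    (ha : a + p + s₂ ≤ b + s₁) : factorAt u s₁ n ≠ factorAt u s₂ n := by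
  intro heq
  rw [factorAt_eq_iff] at heq
  have h₁ := heq (b - s₂) (by omega)
  have h₂ := heq (b - s₂ - p) (by omega)
  have h₃ := h (s₁ + (b - s₂ - p)) (by omega) (by omega)
  rw [show s₂ + (b - s₂) = b by omega] at h₁
  rw [show s₂ + (b - s₂ - p) = b - p by omega] at h₂
  rw [show s₁ + (b - s₂ - p) + p = s₁ + (b - s₂) by omega] at h₃
  exact hb (by rw [← h₁, ← h₂, h₃])

/-- `w` occurs in `x` at an offset at most `q`. -/
def OccursWithin (k q : ℕ) (w x : List α) : Prop := ∃ j ≤ q, w = (x.drop j).take k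

theorem occursWithin_factorAt_iff {u : ℕ → α} {k q s : ℕ} {w : List α} :
    OccursWithin k q w (factorAt u s (k + q)) ↔ ∃ j ≤ q, w = factorAt u (s + j) k := by
  constructor <;> rintro ⟨j, hj, rfl⟩ <;> refine ⟨j, hj, ?_⟩ <;>
    rw [take_drop_factorAt u (by omega)]

theorem le_card_of_factorAt_ne {u : ℕ → α} {n m : ℕ} {F : Finset (List α)} (f : ℕ → ℕ)
    (hF : ∀ j < m, factorAt u (f j) n ∈ F)
    (hf : ∀ i j, i < j → j < m → factorAt u (f i) n ≠ factorAt u (f j) n) : m ≤ F.card := by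
  have := Finset.card_le_card_of_injOn (s := Finset.range m) (t := F)
    (fun j => factorAt u (f j) n) (fun j hj => hF j (by simpa using hj)) (by
      intro i hi j hj hij
      simp only [Finset.coe_range, Set.mem_Iio] at hi hj
      rcases lt_trichotomy i j with h | h | h
      · exact absurd hij (hf i j h hj)
      · exact h
      · exact absurd hij.symm (hf j i h hi))
  simpa using this

section Counting

variable [Fintype α]

theorem finite_setOf_length_eq_and (k : ℕ) (p : List α → Prop) :
    {w : List α | w.length = k ∧ p w}.Finite :=
  (List.finite_length_eq α k).subset fun _ hw => hw.1

/-- The finite set of factors of length `k`. -/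
noncomputable def factorFinset (u : ℕ → α) (k : ℕ) : Finset (List α) :=
  (finite_setOf_length_eq_and k (IsFactor u)).toFinset

/-- The finite set of palindromic factors of length `k`. -/
noncomputable def palindromeFinset (u : ℕ → α) (k : ℕ) : Finset (List α) :=
  (finite_setOf_length_eq_and k fun w => IsFactor u w ∧ IsPalindrome w).toFinset

theorem card_factorFinset (u : ℕ → α) (k : ℕ) :
    (factorFinset u k).card = facComplexity u k :=
  (Set.ncard_eq_toFinset_card _ _).symm

theorem card_palindromeFinset (u : ℕ → α) (k : ℕ) :
    (palindromeFinset u k).card = palComplexity u k :=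
  (Set.ncard_eq_toFinset_card _ _).symm

theorem factorAt_mem_factorFinset (u : ℕ → α) (i k : ℕ) :
    factorAt u i k ∈ factorFinset u k := by
  simp [factorFinset, length_factorAt, isFactor_factorAt]

theorem exists_of_mem_factorFinset {u : ℕ → α} {k : ℕ} {w : List α}
    (h : w ∈ factorFinset u k) : ∃ i, w = factorAt u i k := by
  simp only [factorFinset, Set.Finite.mem_toFinset, Set.mem_ofPred_eq] at h
  obtain ⟨rfl, h⟩ := h
  exact h

theorem exists_of_mem_palindromeFinset {u : ℕ → α} {k : ℕ} {w : List α}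
    (h : w ∈ palindromeFinset u k) : ∃ i, w = factorAt u i k := by
  simp only [palindromeFinset, Set.Finite.mem_toFinset, Set.mem_ofPred_eq] at h
  obtain ⟨rfl, h, -⟩ := h
  exact h

theorem isPalindromeAt_of_mem {u : ℕ → α} {k c : ℕ}
    (h : factorAt u c k ∈ palindromeFinset u k) : IsPalindromeAt u k c := by
  simp only [palindromeFinset, Set.Finite.mem_toFinset, Set.mem_ofPred_eq] at h
  exact h.2.2.isPalindromeAt

open Classical in
theorem card_filter_palindromeFinset_le_two {u : ℕ → α} {k q : ℕ} (hq : 4 * q ≤ k)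
    {x : List α} (hx : x ∈ factorFinset u (k + q)) :
    ((palindromeFinset u k).filter (OccursWithin k q · x)).card ≤ 2 := by
  obtain ⟨s, rfl⟩ := exists_of_mem_factorFinset hx
  by_contra! hlt
  obtain ⟨w₁, w₂, w₃, hw₁, hw₂, hw₃, h₁₂, h₁₃, h₂₃⟩ := Finset.two_lt_card_iff.1 hlt
  simp only [Finset.mem_filter, occursWithin_factorAt_iff] at hw₁ hw₂ hw₃
  obtain ⟨hp₁, i₁, hi₁, rfl⟩ := hw₁
  obtain ⟨hp₂, i₂, hi₂, rfl⟩ := hw₂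
  obtain ⟨hp₃, i₃, hi₃, rfl⟩ := hw₃
  have key : ∀ a b c, a ≤ b → b ≤ c → c ≤ q → factorAt u (s + a) k ∈ palindromeFinset u k →
      factorAt u (s + b) k ∈ palindromeFinset u k → factorAt u (s + c) k ∈ palindromeFinset u k →
      factorAt u (s + a) k = factorAt u (s + b) k ∨
      factorAt u (s + b) k = factorAt u (s + c) k ∨
      factorAt u (s + a) k = factorAt u (s + c) k := by
    intro a b c hab hbc hc ha hb hcp
    obtain ⟨d, rfl⟩ := Nat.exists_eq_add_of_le hab
    obtain ⟨e, rfl⟩ := Nat.exists_eq_add_of_le hbc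
    simp only [← add_assoc] at ha hb hcp ⊢
    exact factorAt_eq_of_isPalindromeAt hq (by omega) (isPalindromeAt_of_mem ha)
      (isPalindromeAt_of_mem hb) (isPalindromeAt_of_mem hcp)
  rcases le_total i₁ i₂ with h | h <;> rcases le_total i₂ i₃ with h' | h' <;>
    rcases le_total i₁ i₃ with h'' | h''
  · rcases key i₁ i₂ i₃ h h' hi₃ hp₁ hp₂ hp₃ with h | h | h <;> simp_all
  · rcases key i₁ i₂ i₃ h h' hi₃ hp₁ hp₂ hp₃ with h | h | h <;> simp_all
  · rcases key i₁ i₃ i₂ h'' h' hi₂ hp₁ hp₃ hp₂ with h | h | h <;> simp_all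
  · rcases key i₃ i₁ i₂ h'' h hi₂ hp₃ hp₁ hp₂ with h | h | h <;> simp_all
  · rcases key i₂ i₁ i₃ h h'' hi₃ hp₂ hp₁ hp₃ with h | h | h <;> simp_all
  · rcases key i₂ i₃ i₁ h' h'' hi₁ hp₂ hp₃ hp₁ with h | h | h <;> simp_all
  · rcases key i₃ i₂ i₁ h' h hi₁ hp₃ hp₂ hp₁ with h | h | h <;> simp_all
  · rcases key i₃ i₂ i₁ h' h hi₁ hp₃ hp₂ hp₁ with h | h | h <;> simp_all

open Classical in
/-- A factor of length `k` that occurs far enough from the beginning is contained in more than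
`k / 8` factors of length `k + q`. -/
theorem lt_card_filter_factorFinset {u : ℕ → α} (hu : ¬ UltimatelyPeriodic u) {k q i : ℕ}
    (hq : 4 * q ≤ k) (hk : k < 4 * q + 4) (hi : q ≤ i) :
    k < 8 * ((factorFinset u (k + q)).filter (OccursWithin k q (factorAt u i k))).card := by
  by_cases hper : ∃ p, 1 ≤ p ∧ 8 * p ≤ k ∧ HasPeriodOn u i (i + k) p
  · obtain ⟨p, hp1, hpk, hper⟩ := hper
    obtain ⟨b, hb, -, hrun, hbreak⟩ := hper.exists_break hu hp1
    obtain ⟨e, t, m, he, het, ht⟩ : ∃ e t m, e = p * m ∧ i + e + k + t = b ∧ t < p :=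
      ⟨p * ((b - k - i) / p), (b - k - i) % p, _, rfl, by
        have := Nat.div_add_mod (b - k - i) p
        omega, Nat.mod_lt _ hp1⟩
    have hw : factorAt u i k = factorAt u (i + e) k := hrun.factorAt_eq he le_rfl (by omega)
    have hcard : q + 1 - p ≤
        ((factorFinset u (k + q)).filter (OccursWithin k q (factorAt u i k))).card := by
      refine le_card_of_factorAt_ne (u := u) (n := k + q) (fun j => i + e - j) ?_ ?_
      · intro j hj
        rw [Finset.mem_filter, occursWithin_factorAt_iff, hw]
        exact ⟨factorAt_mem_factorFinset _ _ _, j, by omega, by congr 1; omega⟩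
      · intro j j' hjj hj'
        exact (hrun.factorAt_ne hbreak (by omega) (by omega) (by omega) (by omega)).symm
    omega
  · have hcard : k / 8 + 1 ≤
        ((factorFinset u (k + q)).filter (OccursWithin k q (factorAt u i k))).card := by
      refine le_card_of_factorAt_ne (u := u) (n := k + q) (fun j => i - j) ?_ ?_
      · intro j hj
        rw [Finset.mem_filter, occursWithin_factorAt_iff]
        exact ⟨factorAt_mem_factorFinset _ _ _, j, by omega, by congr 1; omega⟩
      · intro j j' hjj hj' heq
        refine hper ⟨j' - j, by omega, by omega, fun n hn hlt => ?_⟩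
        have h := factorAt_eq_iff.1 heq (n - i + j') (by omega)
        rw [show i - j + (n - i + j') = n + (j' - j) by omega,
          show i - j' + (n - i + j') = n by omega] at h
        exact h.symm
    omega

/-- A sequence with few factors of length `n` is ultimately periodic. -/
theorem le_two_mul_card_factorFinset {u : ℕ → α} (hu : ¬ UltimatelyPeriodic u) (n : ℕ) :
    n ≤ 2 * (factorFinset u n).card := by
  by_contra! hlt
  obtain ⟨s₁, s₂, hs, hs₂, heq⟩ : ∃ s₁ s₂, s₁ < s₂ ∧ s₂ < (factorFinset u n).card + 1 ∧
      factorAt u s₁ n = factorAt u s₂ n := by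
    by_contra! hcon
    have := le_card_of_factorAt_ne (u := u) (n := n) (F := factorFinset u n)
      (m := (factorFinset u n).card + 1) id (fun j _ => factorAt_mem_factorFinset _ _ _) hcon
    omega
  have hper : HasPeriodOn u s₁ (s₂ + n) (s₂ - s₁) := by
    intro i hi hilt
    have := factorAt_eq_iff.1 heq (i - s₁) (by omega)
    rw [show s₁ + (i - s₁) = i by omega, show s₂ + (i - s₁) = i + (s₂ - s₁) by omega] at this
    exact this
  obtain ⟨b, hb, -, hrun, hbreak⟩ := hper.exists_break hu (by omega)
  have := le_card_of_factorAt_ne (u := u) (n := n) (F := factorFinset u n)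
    (m := n - (s₂ - s₁)) (fun j => b + 1 + j - n) (fun j _ => factorAt_mem_factorFinset _ _ _)
    (fun j j' hjj hj' =>
      hrun.factorAt_ne hbreak (by omega) (by omega) (by omega) (by omega))
  omega

open Classical in
/-- At least `k / 4` factors of length `k + q` contain at most one palindrome of length `k`. -/
theorem le_card_filter_card_le_one {u : ℕ → α} (hu : ¬ UltimatelyPeriodic u) {k q : ℕ}
    (hq : 4 * q ≤ k) :
    k ≤ 4 * ((factorFinset u (k + q)).filter fun x =>
      ((palindromeFinset u k).filter (OccursWithin k q · x)).card ≤ 1).card := by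
  by_cases hex : ∃ d, d ≤ q ∧ ∃ c, factorAt u c k ∈ palindromeFinset u k ∧
      factorAt u (c + d) k ∈ palindromeFinset u k ∧ factorAt u c k ≠ factorAt u (c + d) k
  · obtain ⟨hdq, c, hc, hcd, hne⟩ := Nat.find_spec hex
    have hmin := fun m => @Nat.find_min _ _ hex m
    generalize Nat.find hex = d at hdq hcd hne hmin
    have hd : 1 ≤ d := by
      rcases Nat.eq_zero_or_pos d with rfl | h
      · exact absurd rfl hne
      · exact h
    have hper := (isPalindromeAt_of_mem hc).hasPeriodOn (isPalindromeAt_of_mem hcd)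
    obtain ⟨b, hb, -, hrun, hbreak⟩ := hper.exists_break hu (by omega)
    have key : ∀ s j j', j < j' → j' ≤ q → b < s + (k + d) → s + (2 * q + 2 * d) ≤ b →
        factorAt u (s + j) k ∈ palindromeFinset u k →
        factorAt u (s + j') k ∈ palindromeFinset u k →
        factorAt u (s + j) k = factorAt u (s + j') k := by
      intro s j j' hjj hj' hs hs' hp hp'
      by_contra hne'
      obtain ⟨e, rfl⟩ := Nat.exists_eq_add_of_le hjj.le
      rw [← add_assoc] at hp' hne'
      have hde : d ≤ e := by
        by_contra! hlt
        exact hmin e hlt ⟨by omega, s + j, hp, hp', hne'⟩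
      have hper' := (isPalindromeAt_of_mem hp).hasPeriodOn (isPalindromeAt_of_mem hp')
      have h₁ := hper' (b - 2 * e) (by omega) (by omega)
      have h₂ := hrun (b - 2 * e - 2 * d) (by omega) (by omega)
      have h₃ := hper' (b - 2 * e - 2 * d) (by omega) (by omega)
      rw [show b - 2 * e + 2 * e = b by omega] at h₁
      rw [show b - 2 * e - 2 * d + 2 * d = b - 2 * e by omega] at h₂
      rw [show b - 2 * e - 2 * d + 2 * e = b - 2 * d by omega] at h₃
      exact hbreak (by rw [← h₁, ← h₂, h₃])
    have := le_card_of_factorAt_ne (u := u) (n := k + q)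
      (F := (factorFinset u (k + q)).filter fun x =>
        ((palindromeFinset u k).filter (OccursWithin k q · x)).card ≤ 1)
      (m := k - 2 * q - d) (fun j => b + 1 + j - (k + d)) (by
        intro r hr
        rw [Finset.mem_filter]
        refine ⟨factorAt_mem_factorFinset _ _ _, Finset.card_le_one.2 ?_⟩
        intro w hw w' hw'
        simp only [Finset.mem_filter, occursWithin_factorAt_iff] at hw hw'
        obtain ⟨hp, j, hj, rfl⟩ := hw
        obtain ⟨hp', j', hj', rfl⟩ := hw'
        rcases lt_trichotomy j j' with h | rfl | h
        · exact key _ _ _ h hj' (by omega) (by omega) hp hp'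
        · rfl
        · exact (key _ _ _ h hj (by omega) (by omega) hp' hp).symm)
      (fun j j' hjj hj' =>
        hrun.factorAt_ne hbreak (by omega) (by omega) (by omega) (by omega))
    omega
  · push Not at hex
    rw [Finset.filter_true_of_mem]
    · have := le_two_mul_card_factorFinset hu (k + q)
      omega
    · intro x hx
      obtain ⟨s, rfl⟩ := exists_of_mem_factorFinset hx
      refine Finset.card_le_one.2 fun w hw w' hw' => ?_
      simp only [Finset.mem_filter, occursWithin_factorAt_iff] at hw hw'
      obtain ⟨hp, j, hj, rfl⟩ := hw
      obtain ⟨hp', j', hj', rfl⟩ := hw'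
      rcases le_total j j' with h | h
      · obtain ⟨e, rfl⟩ := Nat.exists_eq_add_of_le h
        rw [← add_assoc] at hp' ⊢
        exact hex e (by omega) _ hp hp'
      · obtain ⟨e, rfl⟩ := Nat.exists_eq_add_of_le h
        rw [← add_assoc] at hp ⊢
        exact (hex e (by omega) _ hp' hp).symm

end Counting

/-- Upper bound for the palindrome complexity in terms of the block complexity:
for a non-ultimately-periodic sequence, `k · pal(k) < 16 · fac(k + ⌊k/4⌋)`. -/
theorem stmt13 {α : Type*} [Fintype α] (u : ℕ → α)
    (hu : ¬ UltimatelyPeriodic u) :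
    ∀ k, 1 ≤ k →
      k * palComplexity u k < 16 * facComplexity u (k + k / 4) := by
  classical
  intro k hk
  obtain ⟨q, hq⟩ : ∃ q, q = k / 4 := ⟨_, rfl⟩
  rw [← card_palindromeFinset, ← card_factorFinset, ← hq]
  have hq₁ : 4 * q ≤ k := by omega
  have hq₂ : k < 4 * q + 4 := by omega
  set P := palindromeFinset u k with hP
  set F := factorFinset u (k + q) with hF
  set S := F.filter fun x => (P.filter (OccursWithin k q · x)).card ≤ 1 with hS
  have hSk : k ≤ 4 * S.card := le_card_filter_card_le_one hu hq₁
  have hSF : S.card ≤ F.card := Finset.card_filter_le _ _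
  set G := P.filter fun w => ∃ i, q ≤ i ∧ w = factorAt u i k with hG
  have hbad : (P.filter fun w => ¬ ∃ i, q ≤ i ∧ w = factorAt u i k).card ≤ 2 := by
    refine (Finset.card_le_card ?_).trans
      (card_filter_palindromeFinset_le_two hq₁ (factorAt_mem_factorFinset u 0 (k + q)))
    intro w hw
    rw [Finset.mem_filter] at hw ⊢
    obtain ⟨i, rfl⟩ := exists_of_mem_palindromeFinset hw.1
    refine ⟨hw.1, occursWithin_factorAt_iff.2 ⟨i, ?_, by rw [zero_add]⟩⟩
    by_contra! hlt
    exact hw.2 ⟨i, hlt.le, rfl⟩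
  have hsplit : G.card + (P.filter fun w => ¬ ∃ i, q ≤ i ∧ w = factorAt u i k).card = P.card :=
    Finset.card_filter_add_card_filter_not _
  have hpairs : ∑ w ∈ G, (F.filter (OccursWithin k q w)).card + S.card ≤ 2 * F.card := by
    have hswap : ∑ w ∈ G, (F.filter (OccursWithin k q w)).card
        = ∑ x ∈ F, (G.filter (OccursWithin k q · x)).card :=
      Finset.sum_card_bipartiteAbove_eq_sum_card_bipartiteBelow _
    rw [hswap, hS, Finset.card_filter, ← Finset.sum_add_distrib, mul_comm, ← smul_eq_mul]
    refine Finset.sum_le_card_nsmul _ _ _ fun x hx => ?_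
    have h₁ : (G.filter (OccursWithin k q · x)).card
        ≤ (P.filter (OccursWithin k q · x)).card :=
      Finset.card_le_card (Finset.filter_subset_filter _ (Finset.filter_subset _ _))
    have h₂ : (P.filter (OccursWithin k q · x)).card ≤ 2 :=
      card_filter_palindromeFinset_le_two hq₁ hx
    split_ifs <;> omega
  have hgood : G.card * (k + 1) ≤ 8 * ∑ w ∈ G, (F.filter (OccursWithin k q w)).card := by
    rw [Finset.mul_sum, ← smul_eq_mul]
    refine Finset.card_nsmul_le_sum _ _ _ fun w hw => ?_
    obtain ⟨i, hi, rfl⟩ := (Finset.mem_filter.1 hw).2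
    exact lt_card_filter_factorFinset hu hq₁ hq₂ hi
  rcases Nat.eq_zero_or_pos G.card with h0 | hpos
  · have : P.card ≤ 2 := by omega
    nlinarith
  · have : P.card ≤ G.card + 2 := by omega
    nlinarith

end PalPaper
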